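/- Let V be a finite-dimensional real vector space with a symmetric bilinear form b, and let α, β ∈ V satisfy b(α,α) = b(β,β) = 2 and b(α,β) = −1. Then the set of tensors w ∈ V ⊗ V ⊗ V that are fixed by every permutation of the three tensor factors and satisfy (s_α ⊗ s_α ⊗ s_α)(w) = −w and (s_β ⊗ s_β ⊗ s_β)(w) = −w is exactly the one-dimensional span of the full symmetrization (1/6)·Σ_{σ∈S₃} σ·(α ⊗ β ⊗ (α+β)) of α ⊗ β ⊗ (α+β). (That is, the restriction of Sym³(V) to ⟨s_α,s_β⟩ ≅ S₃ contains exactly one copy of the sign representation, spanned by α·β·(α+β).) -/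

import Mathlib

open scoped TensorProduct

noncomputable section

/-- The reflection `s_α(v) = v − b(α,v)·α`. -/
def reflB {V : Type*} [AddCommGroup V] [Module ℝ V]
    (b : LinearMap.BilinForm ℝ V) (α : V) : Module.End ℝ V :=
  LinearMap.id - LinearMap.smulRight (b α) α

/-- `f ⊗ f ⊗ f` acting on `(V ⊗ V) ⊗ V`. -/
def cube {V : Type*} [AddCommGroup V] [Module ℝ V] (f : Module.End ℝ V) :
    Module.End ℝ ((V ⊗[ℝ] V) ⊗[ℝ] V) :=
  TensorProduct.map (TensorProduct.map f f) f

/-- The transposition of the first two tensor factors of `(V ⊗ V) ⊗ V`. -/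
def swap12 {V : Type*} [AddCommGroup V] [Module ℝ V] :
    Module.End ℝ ((V ⊗[ℝ] V) ⊗[ℝ] V) :=
  TensorProduct.map (TensorProduct.comm ℝ V V).toLinearMap LinearMap.id

/-- The transposition of the last two tensor factors of `(V ⊗ V) ⊗ V`. -/
def swap23 {V : Type*} [AddCommGroup V] [Module ℝ V] :
    Module.End ℝ ((V ⊗[ℝ] V) ⊗[ℝ] V) :=
  (TensorProduct.assoc ℝ V V V).symm.toLinearMap ∘ₗ
    TensorProduct.map LinearMap.id (TensorProduct.comm ℝ V V).toLinearMap ∘ₗ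
      (TensorProduct.assoc ℝ V V V).toLinearMap

open Module

section TripleEval

variable {V : Type*} [AddCommGroup V] [Module ℝ V]

/-- The functional `f ⊗ g ⊗ h` on `(V ⊗ V) ⊗ V`. -/
def tripleEval (f g h : Dual ℝ V) : Dual ℝ ((V ⊗[ℝ] V) ⊗[ℝ] V) :=
  TensorProduct.dualDistrib ℝ _ _ (TensorProduct.dualDistrib ℝ _ _ (f ⊗ₜ[ℝ] g) ⊗ₜ[ℝ] h)

@[simp] lemma tripleEval_tmul (f g h : Dual ℝ V) (x y z : V) :
    tripleEval f g h ((x ⊗ₜ[ℝ] y) ⊗ₜ[ℝ] z) = f x * g y * h z := by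
  simp [tripleEval]

lemma tripleEval_add_left (f f' g h : Dual ℝ V) (w : (V ⊗[ℝ] V) ⊗[ℝ] V) :
    tripleEval (f + f') g h w = tripleEval f g h w + tripleEval f' g h w := by
  simp [tripleEval, TensorProduct.add_tmul]

lemma tripleEval_smul_left (c : ℝ) (f g h : Dual ℝ V) (w : (V ⊗[ℝ] V) ⊗[ℝ] V) :
    tripleEval (c • f) g h w = c * tripleEval f g h w := by
  simp [tripleEval, ← TensorProduct.smul_tmul']

lemma tripleEval_swap12 (f g h : Dual ℝ V) (w : (V ⊗[ℝ] V) ⊗[ℝ] V) :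
    tripleEval f g h (swap12 w) = tripleEval g f h w := by
  suffices tripleEval f g h ∘ₗ swap12 = tripleEval g f h from LinearMap.congr_fun this w
  ext x y z
  simp [swap12, mul_comm]

lemma tripleEval_swap23 (f g h : Dual ℝ V) (w : (V ⊗[ℝ] V) ⊗[ℝ] V) :
    tripleEval f g h (swap23 w) = tripleEval f h g w := by
  suffices tripleEval f g h ∘ₗ swap23 = tripleEval f h g from LinearMap.congr_fun this w
  ext x y z
  simp [swap23, mul_right_comm]

lemma tripleEval_cube (s : End ℝ V) (f g h : Dual ℝ V) (w : (V ⊗[ℝ] V) ⊗[ℝ] V) :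
    tripleEval f g h (cube s w) = tripleEval (f ∘ₗ s) (g ∘ₗ s) (h ∘ₗ s) w := by
  suffices tripleEval f g h ∘ₗ cube s = tripleEval (f ∘ₗ s) (g ∘ₗ s) (h ∘ₗ s) from
    LinearMap.congr_fun this w
  ext x y z
  simp [cube]

/-- The functionals `f ⊗ g ⊗ h` separate the points of `(V ⊗ V) ⊗ V`. -/
lemma eq_zero_of_tripleEval_eq_zero {w : (V ⊗[ℝ] V) ⊗[ℝ] V}
    (hw : ∀ f g h : Dual ℝ V, tripleEval f g h w = 0) : w = 0 := by
  let B := Basis.ofVectorSpace ℝ V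
  let C := (B.tensorProduct B).tensorProduct B
  refine C.ext_elem fun ⟨⟨i, j⟩, k⟩ => ?_
  have hcoord : C.coord ((i, j), k) = tripleEval (B.coord i) (B.coord j) (B.coord k) := by
    ext x y z
    simp [C, mul_comm, mul_left_comm]
  simpa [hw] using LinearMap.congr_fun hcoord w

lemma comp_reflB (b : LinearMap.BilinForm ℝ V) (α : V) (f : Dual ℝ V) :
    f ∘ₗ reflB b α = f + (-f α) • b α := by
  ext v
  simp [reflB]
  ring

end TripleEval

section Reflections

variable {V : Type*} [AddCommGroup V] [Module ℝ V]
  {b : LinearMap.BilinForm ℝ V} {α β : V}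

lemma reflB_apply (v : V) : reflB b α v = v - b α v • α := by
  simp [reflB]

/-- An additive and homogeneous function on the dual space that vanishes on `b α`, on `b β` and
on the annihilator of `α` and `β` is zero. -/
lemma dual_eq_zero_of_annihilator (hαα : b α α = 2) (hββ : b β β = 2) (hαβ : b α β = -1)
    (hβα : b β α = -1) {G : Dual ℝ V → ℝ} (hadd : ∀ f g, G (f + g) = G f + G g)
    (hsmul : ∀ (c : ℝ) f, G (c • f) = c * G f) (hα : G (b α) = 0) (hβ : G (b β) = 0)
    (hG : ∀ f : Dual ℝ V, f α = 0 → f β = 0 → G f = 0) (f : Dual ℝ V) : G f = 0 := by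
  set p := (2 * f α + f β) / 3 with hp
  set q := (f α + 2 * f β) / 3 with hq
  have h₀ : G (f + ((-p) • b α + (-q) • b β)) = 0 := by
    apply hG
    · simp [hαα, hβα]
      linarith
    · simp [hαβ, hββ]
      linarith
  simpa [hadd, hsmul, hα, hβ] using h₀

/-- A symmetric trilinear form on the dual space on which both reflections act by `-1` and which
vanishes at `(b α, b α, b α)` is zero. -/
lemma trilinear_eq_zero_of_anti_invariant (hαα : b α α = 2) (hββ : b β β = 2)
    (hαβ : b α β = -1) (hβα : b β α = -1) {F : Dual ℝ V → Dual ℝ V → Dual ℝ V → ℝ}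
    (hadd : ∀ f f' g h, F (f + f') g h = F f g h + F f' g h)
    (hsmul : ∀ (c : ℝ) f g h, F (c • f) g h = c * F f g h)
    (h12 : ∀ f g h, F f g h = F g f h) (h23 : ∀ f g h, F f g h = F f h g)
    (hsα : ∀ f g h, F (f + (-f α) • b α) (g + (-g α) • b α) (h + (-h α) • b α) = -F f g h)
    (hsβ : ∀ f g h, F (f + (-f β) • b β) (g + (-g β) • b β) (h + (-h β) • b β) = -F f g h)
    (hF : F (b α) (b α) (b α) = 0) (f g h : Dual ℝ V) : F f g h = 0 := by
  have hadd₂ f g g' h : F f (g + g') h = F f g h + F f g' h := by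
    rw [h12, hadd, h12 g, h12 g']
  have hsmul₂ (c : ℝ) f g h : F f (c • g) h = c * F f g h := by
    rw [h12, hsmul, h12 g]
  have hadd₃ f g h h' : F f g (h + h') = F f g h + F f g h' := by
    rw [h23, hadd₂, h23 f h, h23 f h']
  have hsmul₃ (c : ℝ) f g h : F f g (c • h) = c * F f g h := by
    rw [h23, hsmul₂, h23 f h]
  have span₃ f g (hα : F f g (b α) = 0) (hβ : F f g (b β) = 0)
      (h₀ : ∀ a : Dual ℝ V, a α = 0 → a β = 0 → F f g a = 0) h : F f g h = 0 :=
    dual_eq_zero_of_annihilator hαα hββ hαβ hβα (hadd₃ f g) (fun c => hsmul₃ c f g) hα hβ h₀ h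
  have span₂ f (hα : ∀ h, F f (b α) h = 0) (hβ : ∀ h, F f (b β) h = 0)
      (h₀ : ∀ a : Dual ℝ V, a α = 0 → a β = 0 → ∀ h, F f a h = 0) g h : F f g h = 0 :=
    span₃ f g (by rw [h23, hα]) (by rw [h23, hβ]) (fun a hα hβ => by rw [h23, h₀ a hα hβ]) h
  have ann₂ (a : Dual ℝ V) (aα : a α = 0) (aβ : a β = 0) (a' : Dual ℝ V) (aα' : a' α = 0)
      (aβ' : a' β = 0) : ∀ h, F a a' h = 0 := by
    have eα := hsα a a' (b β)
    have eβ := hsβ a a' (b α)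
    simp only [aα, aβ, aα', aβ', hαβ, hβα, hadd₃, hsmul₃, neg_zero, zero_smul, add_zero] at eα eβ
    refine span₃ a a' (by linarith) (by linarith) fun a'' aα'' aβ'' => ?_
    have e := hsα a a' a''
    simp only [aα, aα', aα'', neg_zero, zero_smul, add_zero] at e
    linarith
  have ann₁ (a : Dual ℝ V) (aα : a α = 0) (aβ : a β = 0) : ∀ g h, F a g h = 0 := by
    have eαα := hsα a (b α) (b α)
    have eββ := hsβ a (b β) (b β)
    have eαβ := hsα a (b β) (b β)
    have hsymm := h23 a (b α) (b β)
    simp only [aα, aβ, hαα, hββ, hβα, hadd₂, hsmul₂, hadd₃, hsmul₃, neg_zero,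
      zero_smul, add_zero] at eαα eββ eαβ
    refine span₂ a
      (span₃ a _ (by linarith) (by linarith) fun a' aα' aβ' => ?_)
      (span₃ a _ (by linarith) (by linarith) fun a' aα' aβ' => ?_) (ann₂ a aα aβ) <;>
    rw [h23, ann₂ a aα aβ a' aα' aβ']
  have e₁ := hsα (b α) (b α) (b β)
  have e₂ := hsβ (b β) (b β) (b α)
  have e₃ := hsα (b β) (b β) (b β)
  have s₁ := h23 (b α) (b α) (b β)
  have s₂ := h12 (b α) (b β) (b α)
  have s₃ := h23 (b β) (b α) (b β)
  have s₄ := h12 (b α) (b β) (b β)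
  simp only [hαα, hββ, hαβ, hβα, hadd, hsmul, hadd₂, hsmul₂, hadd₃, hsmul₃] at e₁ e₂ e₃
  have perp f g (a : Dual ℝ V) (aα : a α = 0) (aβ : a β = 0) : F f g a = 0 := by
    rw [h23, h12, ann₁ a aα aβ]
  have perp₂ f (a : Dual ℝ V) (aα : a α = 0) (aβ : a β = 0) h : F f a h = 0 := by
    rw [h12, ann₁ a aα aβ]
  have vα : ∀ g h, F (b α) g h = 0 := span₂ _
    (span₃ _ _ (by linarith) (by linarith) (perp _ _))
    (span₃ _ _ (by linarith) (by linarith) (perp _ _)) (perp₂ _)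
  have vβ : ∀ g h, F (b β) g h = 0 := span₂ _
    (span₃ _ _ (by linarith) (by linarith) (perp _ _))
    (span₃ _ _ (by linarith) (by linarith) (perp _ _)) (perp₂ _)
  exact span₂ f (fun h => by rw [h12, vα]) (fun h => by rw [h12, vβ]) (perp₂ f) g h

/-- A symmetric tensor on which both reflections act by `-1` and at which `b α ⊗ b α ⊗ b α`
vanishes is zero. -/
lemma eq_zero_of_anti_invariant (hαα : b α α = 2) (hββ : b β β = 2)
    (hαβ : b α β = -1) (hβα : b β α = -1) {w : (V ⊗[ℝ] V) ⊗[ℝ] V}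
    (h12 : swap12 w = w) (h23 : swap23 w = w) (hsα : cube (reflB b α) w = -w)
    (hsβ : cube (reflB b β) w = -w) (hw : tripleEval (b α) (b α) (b α) w = 0) : w = 0 := by
  refine eq_zero_of_tripleEval_eq_zero <| trilinear_eq_zero_of_anti_invariant hαα hββ hαβ hβα
    (F := fun f g h => tripleEval f g h w) (fun f f' g h => tripleEval_add_left f f' g h w)
    (fun c f g h => tripleEval_smul_left c f g h w) (fun f g h => ?_) (fun f g h => ?_)
    (fun f g h => ?_) (fun f g h => ?_) hw
  · rw [← tripleEval_swap12, h12]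
  · rw [← tripleEval_swap23, h23]
  · simp only [← comp_reflB, ← tripleEval_cube, hsα, map_neg]
  · simp only [← comp_reflB, ← tripleEval_cube, hsβ, map_neg]

end Reflections

/-- If `b(α,α) = b(β,β) = 2` and `b(α,β) = −1`, the symmetric tensors `w ∈ Sym³(V)`
(fixed by all permutations of the three factors, equivalently by the two generating
transpositions) on which both `s_α⊗s_α⊗s_α` and `s_β⊗s_β⊗s_β` act by `−1` form
exactly the one-dimensional span of the full symmetrization of `α ⊗ β ⊗ (α+β)`. -/
theorem statement8 {V : Type*} [AddCommGroup V] [Module ℝ V] [FiniteDimensional ℝ V]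
    (b : LinearMap.BilinForm ℝ V) (hb : b.IsSymm)
    (α β : V) (hαα : b α α = 2) (hββ : b β β = 2) (hαβ : b α β = -1) :
    (1/6 : ℝ) • ((α ⊗ₜ[ℝ] β) ⊗ₜ[ℝ] (α + β) + (α ⊗ₜ[ℝ] (α + β)) ⊗ₜ[ℝ] β
      + (β ⊗ₜ[ℝ] α) ⊗ₜ[ℝ] (α + β) + (β ⊗ₜ[ℝ] (α + β)) ⊗ₜ[ℝ] α
      + ((α + β) ⊗ₜ[ℝ] α) ⊗ₜ[ℝ] β + ((α + β) ⊗ₜ[ℝ] β) ⊗ₜ[ℝ] α) ≠ 0 ∧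
    {w : (V ⊗[ℝ] V) ⊗[ℝ] V | swap12 w = w ∧ swap23 w = w ∧
        cube (reflB b α) w = -w ∧ cube (reflB b β) w = -w}
      = ↑(Submodule.span ℝ {(1/6 : ℝ) • ((α ⊗ₜ[ℝ] β) ⊗ₜ[ℝ] (α + β)
          + (α ⊗ₜ[ℝ] (α + β)) ⊗ₜ[ℝ] β + (β ⊗ₜ[ℝ] α) ⊗ₜ[ℝ] (α + β)
          + (β ⊗ₜ[ℝ] (α + β)) ⊗ₜ[ℝ] α + ((α + β) ⊗ₜ[ℝ] α) ⊗ₜ[ℝ] β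
          + ((α + β) ⊗ₜ[ℝ] β) ⊗ₜ[ℝ] α)}) := by
  have hβα : b β α = -1 := by rw [← hαβ]; exact hb.eq β α
  have sαα : reflB b α α = -α := by rw [reflB_apply, hαα]; module
  have sαβ : reflB b α β = α + β := by rw [reflB_apply, hαβ]; module
  have sββ : reflB b β β = -β := by rw [reflB_apply, hββ]; module
  have sβα : reflB b β α = α + β := by rw [reflB_apply, hβα]; module
  have sα : reflB b α (α + β) = β := by rw [map_add, sαα, sαβ]; abel
  have sβ : reflB b β (α + β) = α := by rw [map_add, sββ, sβα]; abel
  set T := (1/6 : ℝ) • ((α ⊗ₜ[ℝ] β) ⊗ₜ[ℝ] (α + β) + (α ⊗ₜ[ℝ] (α + β)) ⊗ₜ[ℝ] β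
      + (β ⊗ₜ[ℝ] α) ⊗ₜ[ℝ] (α + β) + (β ⊗ₜ[ℝ] (α + β)) ⊗ₜ[ℝ] α
      + ((α + β) ⊗ₜ[ℝ] α) ⊗ₜ[ℝ] β + ((α + β) ⊗ₜ[ℝ] β) ⊗ₜ[ℝ] α) with hT
  have evT : tripleEval (b α) (b α) (b α) T = -2 := by
    simp only [hT, map_smul, map_add, tripleEval_tmul, hαα, hαβ, smul_eq_mul]
    norm_num
  have T12 : swap12 T = T := by
    simp only [hT, swap12, map_smul, map_add (TensorProduct.map _ _), TensorProduct.map_tmul,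
      LinearEquiv.coe_coe, TensorProduct.comm_tmul, LinearMap.id_apply]
    abel_nf
  have T23 : swap23 T = T := by
    simp only [hT, swap23, LinearMap.comp_apply, map_smul, map_add (TensorProduct.map _ _),
      map_add (TensorProduct.assoc ℝ V V V), map_add (TensorProduct.assoc ℝ V V V).symm,
      TensorProduct.map_tmul, LinearEquiv.coe_coe, TensorProduct.comm_tmul, LinearMap.id_apply,
      TensorProduct.assoc_tmul, TensorProduct.assoc_symm_tmul]
    abel_nf
  have Tα : cube (reflB b α) T = -T := by
    simp only [hT, cube, map_smul, map_add (TensorProduct.map _ _), TensorProduct.map_tmul,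
      sαα, sαβ, sα, TensorProduct.neg_tmul, TensorProduct.tmul_neg]
    module
  have Tβ : cube (reflB b β) T = -T := by
    simp only [hT, cube, map_smul, map_add (TensorProduct.map _ _), TensorProduct.map_tmul,
      sββ, sβα, sβ, TensorProduct.neg_tmul, TensorProduct.tmul_neg]
    module
  refine ⟨fun h => ?_, Set.ext fun w => ?_⟩
  · rw [h, map_zero] at evT
    norm_num at evT
  rw [SetLike.mem_coe, Submodule.mem_span_singleton]
  constructor
  · rintro ⟨h12, h23, hsα, hsβ⟩
    refine ⟨-tripleEval (b α) (b α) (b α) w / 2, (sub_eq_zero.mp ?_).symm⟩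
    apply eq_zero_of_anti_invariant hαα hββ hαβ hβα
    · rw [map_sub, map_smul, h12, T12]
    · rw [map_sub, map_smul, h23, T23]
    · rw [map_sub, map_smul, hsα, Tα]; module
    · rw [map_sub, map_smul, hsβ, Tβ]; module
    · rw [map_sub, map_smul, evT, smul_eq_mul]; ring
  · rintro ⟨c, rfl⟩
    refine ⟨?_, ?_, ?_, ?_⟩
    · rw [map_smul, T12]
    · rw [map_smul, T23]
    · rw [map_smul, Tα, smul_neg]
    · rw [map_smul, Tβ, smul_neg]
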